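/- arXiv:1811.09697 — 3 statements merged into one kernel-verified Lean document; each statement's English description precedes it below -/
import Mathlib

section
/- Let p ≥ 2 be an integer and c ∈ ℂ, with f_c(z) = z^p + c. Then the filled-in Julia set K_c^p = {z ∈ ℂ : (f_c^m(z))_{m≥1} is bounded} is a connected set if and only if 0 ∈ K_c^p, i.e. if and only if the orbit of 0 under f_c is bounded. -/
open Set Metric Topology Bornology

/-- The intersection of a decreasing sequence of compact preconnected sets is preconnected. -/
theorem isPreconnected_iInter_of_antitone {X : Type*} [TopologicalSpace X] [T2Space X]
    [NormalSpace X] {V : ℕ → Set X} (hV : Antitone V) (hc : ∀ n, IsCompact (V n))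
    (hp : ∀ n, IsPreconnected (V n)) : IsPreconnected (⋂ n, V n) := by
  have hcl : IsClosed (⋂ n, V n) := isClosed_iInter fun n => (hc n).isClosed
  rw [isPreconnected_iff_subset_of_fully_disjoint_closed hcl]
  intro u v hu hv huv hd
  obtain ⟨U, W, hU, hW, huU, hvW, hUW⟩ := normal_separation hu hv hd
  obtain ⟨n, hn⟩ := exists_subset_nhds_of_isCompact (U := U ∪ W) hV.directed_ge hc
    fun x hx => (hU.union hW).mem_nhds (union_subset_union huU hvW (huv hx))
  have hsub : ⋂ n, V n ⊆ V n := iInter_subset _ n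
  rcases (hp n).subset_or_subset hU hW hUW hn with h | h
  · left
    intro x hx
    exact (huv hx).resolve_right fun hxv => disjoint_left.1 hUW (h (hsub hx)) (hvW hxv)
  · right
    intro x hx
    exact (huv hx).resolve_left fun hxu => disjoint_left.1 hUW (huU hxu) (h (hsub hx))

/-- If a map is open and closed and some point of a preconnected set `D` has a single preimage,
then the preimage of `D` is preconnected. -/
theorem IsPreconnected.preimage_of_isOpenMap_of_isClosedMap {X Y : Type*} [TopologicalSpace X]
    [TopologicalSpace Y] {f : X → Y} (ho : IsOpenMap f) (hcl : IsClosedMap f) {D : Set Y}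
    (hD : IsPreconnected D) {a : X} (ha : f a ∈ D) (huniq : ∀ x, f x = f a → x = a) :
    IsPreconnected (f ⁻¹' D) := by
  have key : ∀ U V : Set X, IsOpen U → IsOpen V → f ⁻¹' D ⊆ U ∪ V → (f ⁻¹' D ∩ V).Nonempty →
      a ∈ U → (f ⁻¹' D ∩ (U ∩ V)).Nonempty := by
    intro U V hU hV hUV ⟨v, hvD, hvV⟩ haU
    obtain ⟨d, hdD, hdU, x, hxV, rfl⟩ := hD (f '' Uᶜ)ᶜ (f '' V)
      (hcl _ hU.isClosed_compl).isOpen_compl (ho _ hV)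
      (by
        intro d hd
        by_cases h : d ∈ f '' Uᶜ
        · obtain ⟨u, hu, rfl⟩ := h
          exact Or.inr ⟨u, (hUV hd).resolve_left hu, rfl⟩
        · exact Or.inl h)
      ⟨f a, ha, by
        rintro ⟨u, hu, hua⟩
        exact hu (huniq u hua ▸ haU)⟩
      ⟨f v, hvD, v, hvV, rfl⟩
    exact ⟨x, hdD, by_contra fun hx => hdU ⟨x, fun hxU => hx ⟨hxU, hxV⟩, rfl⟩⟩
  intro U V hU hV hUV hnU hnV
  rcases hUV ha with h | h
  · exact key U V hU hV hUV hnV h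
  · rw [inter_comm U V]
    exact key V U hV hU (union_comm U V ▸ hUV) hnU h

/-- The map `z ↦ z - w` has a continuous `p`-th root on `K`. -/
def HasContinuousRoot (p : ℕ) (K : Set ℂ) (w : ℂ) : Prop :=
  ∃ g : ℂ → ℂ, ContinuousOn g K ∧ ∀ z ∈ K, g z ^ p = z - w

/-- A continuous function within distance less than `1` of `1` has a continuous `p`-th root. -/
theorem exists_continuousOn_root_one_add {p : ℕ} (hp : p ≠ 0) {K : Set ℂ} {u : ℂ → ℂ}
    (hu : ContinuousOn u K) (h1 : ∀ z ∈ K, ‖u z‖ < 1) :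
    ∃ r : ℂ → ℂ, ContinuousOn r K ∧ ∀ z ∈ K, r z ^ p = 1 + u z :=
  ⟨fun z => (1 + u z) ^ ((p : ℂ)⁻¹),
    (continuousOn_const.add hu).cpow continuousOn_const
      fun z hz => Complex.mem_slitPlane_of_norm_lt_one (h1 z hz),
    fun _ _ => Complex.cpow_nat_inv_pow _ hp⟩

theorem hasContinuousRoot_of_norm_lt {p : ℕ} (hp : p ≠ 0) {K : Set ℂ} {w : ℂ}
    (h : ∀ z ∈ K, ‖z‖ < ‖w‖) : HasContinuousRoot p K w := by
  obtain ⟨r, hr, hrp⟩ := exists_continuousOn_root_one_add hp (K := K) (u := fun z => -(z / w))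
    (by fun_prop) (fun z hz => by
      have := h z hz
      rw [norm_neg, norm_div, div_lt_one ((norm_nonneg z).trans_lt this)]
      exact this)
  refine ⟨fun z => (-w) ^ ((p : ℂ)⁻¹) * r z, continuousOn_const.mul hr, fun z hz => ?_⟩
  have hw : w ≠ 0 := norm_pos_iff.1 ((norm_nonneg z).trans_lt (h z hz))
  rw [mul_pow, Complex.cpow_nat_inv_pow _ hp, hrp z hz]
  field_simp
  ring

theorem hasContinuousRoot_iff_of_norm_sub_lt {p : ℕ} (hp : p ≠ 0) {K : Set ℂ} {w w' : ℂ}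
    (h : ∀ z ∈ K, ‖w - w'‖ < ‖z - w‖) :
    HasContinuousRoot p K w ↔ HasContinuousRoot p K w' := by
  have hne : ∀ z ∈ K, z - w ≠ 0 := fun z hz => norm_pos_iff.1 ((norm_nonneg _).trans_lt (h z hz))
  have hne' : ∀ z ∈ K, z - w' ≠ 0 := fun z hz h0 => by
    have := h z hz
    rw [sub_eq_zero.1 h0, norm_sub_rev] at this
    exact lt_irrefl _ this
  obtain ⟨r, hr, hrp⟩ := exists_continuousOn_root_one_add hp (K := K)
    (u := fun z => (w - w') / (z - w)) (continuousOn_const.div (by fun_prop) hne)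
    (fun z hz => by
      rw [norm_div, div_lt_one (norm_pos_iff.2 (hne z hz))]
      exact h z hz)
  have hrq : ∀ z ∈ K, r z ^ p = (z - w') / (z - w) := fun z hz => by
    have := hne z hz
    rw [hrp z hz]
    field_simp
    ring
  constructor
  · rintro ⟨g, hg, hgp⟩
    refine ⟨fun z => g z * r z, hg.mul hr, fun z hz => ?_⟩
    rw [mul_pow, hgp z hz, hrq z hz, mul_div_cancel₀ _ (hne z hz)]
  · rintro ⟨g, hg, hgp⟩
    refine ⟨fun z => g z / r z, hg.div hr fun z hz h0 => ?_, fun z hz => ?_⟩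
    · have := hrq z hz
      rw [h0, zero_pow hp] at this
      exact div_ne_zero (hne' z hz) (hne z hz) this.symm
    · rw [div_pow, hgp z hz, hrq z hz, div_div_cancel₀ (hne' z hz)]

/-- If points outside the compact set `K` cannot be enclosed by `K`, in the sense that every
bounded open set with frontier in `K` is contained in `K`, then `z ↦ z - w` has a continuous
`p`-th root on `K` for every `w ∉ K`. -/
theorem hasContinuousRoot_of_notMem {p : ℕ} (hp : p ≠ 0) {K : Set ℂ} (hK : IsCompact K)
    (hfill : ∀ U : Set ℂ, IsOpen U → IsBounded U → frontier U ⊆ K → U ⊆ K) {w : ℂ}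
    (hw : w ∉ K) : HasContinuousRoot p K w := by
  have hloc : ∀ w ∉ K, ∃ ε > 0, ball w ε ⊆ Kᶜ ∧
      ∀ w' ∈ ball w ε, (HasContinuousRoot p K w ↔ HasContinuousRoot p K w') := by
    intro w hw
    obtain ⟨ε, hε, hb⟩ := Metric.isOpen_iff.1 hK.isClosed.isOpen_compl w hw
    refine ⟨ε, hε, hb, fun w' hw' => hasContinuousRoot_iff_of_norm_sub_lt hp fun z hz => ?_⟩
    rw [mem_ball', dist_eq_norm] at hw'
    refine hw'.trans_le (not_lt.1 fun hlt => hb ?_ hz)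
    rwa [mem_ball, dist_eq_norm]
  by_contra hroot
  set V : Set ℂ := {w | w ∉ K ∧ ¬ HasContinuousRoot p K w} with hV
  have hVo : IsOpen V := by
    rw [Metric.isOpen_iff]
    rintro x ⟨hxK, hx⟩
    obtain ⟨ε, hε, hb, hiff⟩ := hloc x hxK
    exact ⟨ε, hε, fun y hy => ⟨hb hy, fun h => hx ((hiff y hy).2 h)⟩⟩
  obtain ⟨R, hR⟩ := hK.isBounded.exists_norm_le
  have hVb : IsBounded V := by
    refine isBounded_iff_forall_norm_le.2 ⟨R, fun x hx => not_lt.1 fun hlt => hx.2 ?_⟩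
    exact hasContinuousRoot_of_norm_lt hp fun z hz => (hR z hz).trans_lt hlt
  refine hw (hfill V hVo hVb (fun x hx => ?_) ⟨hw, hroot⟩)
  by_contra hxK
  rw [hVo.frontier_eq] at hx
  obtain ⟨ε, hε, hb, hiff⟩ := hloc x hxK
  obtain ⟨y, hyV, hy⟩ := Metric.mem_closure_iff.1 hx.1 ε hε
  refine hx.2 ⟨hxK, fun h => hyV.2 ((hiff y ?_).1 h)⟩
  rwa [mem_ball']

section FilledJulia

variable {p : ℕ} {c : ℂ}

/-- The unicritical polynomial map `z ↦ z ^ p + c`. -/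
def unicritical (p : ℕ) (c : ℂ) : ℂ → ℂ := fun w => w ^ p + c

/-- The filled-in Julia set of `z ↦ z ^ p + c`. -/
def filledJulia (p : ℕ) (c : ℂ) : Set ℂ :=
  {z | IsBounded (range fun m : ℕ => (unicritical p c)^[m] z)}

theorem differentiable_iterate_unicritical (m : ℕ) :
    Differentiable ℂ (unicritical p c)^[m] :=
  Differentiable.iterate (by unfold unicritical; fun_prop) m

theorem two_mul_norm_le_norm_unicritical (hp : 2 ≤ p) {z : ℂ} (hz : ‖c‖ + 2 ≤ ‖z‖) :
    2 * ‖z‖ ≤ ‖unicritical p c z‖ := by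
  have hc := norm_nonneg c
  have h1 : ‖z‖ ^ 2 ≤ ‖z ^ p‖ := by
    rw [norm_pow]
    exact pow_le_pow_right₀ (by linarith) hp
  have h2 : ‖z ^ p‖ - ‖c‖ ≤ ‖z ^ p + c‖ := by
    simpa using norm_sub_norm_le (z ^ p) (-c)
  unfold unicritical
  nlinarith

theorem norm_iterate_le_of_norm_iterate_succ_le (hp : 2 ≤ p) {z : ℂ} {m : ℕ}
    (h : ‖(unicritical p c)^[m + 1] z‖ ≤ ‖c‖ + 2) : ‖(unicritical p c)^[m] z‖ ≤ ‖c‖ + 2 := by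
  by_contra! hlt
  rw [Function.iterate_succ_apply'] at h
  linarith [two_mul_norm_le_norm_unicritical hp hlt.le, norm_nonneg c]

theorem mem_filledJulia_iff (hp : 2 ≤ p) {z : ℂ} :
    z ∈ filledJulia p c ↔ ∀ m, ‖(unicritical p c)^[m] z‖ ≤ ‖c‖ + 2 := by
  constructor
  · intro hz m
    by_contra! hlt
    have hc := norm_nonneg c
    have hgrow : ∀ k : ℕ, 2 ^ k * (‖c‖ + 2) ≤ ‖(unicritical p c)^[k + m] z‖ := by
      intro k
      induction k with
      | zero => simpa using hlt.le
      | succ k ih =>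
        have h1 : (1 : ℝ) ≤ 2 ^ k := one_le_pow₀ one_le_two
        rw [Nat.add_right_comm, Function.iterate_succ_apply']
        have h2 := two_mul_norm_le_norm_unicritical (c := c) hp
          (z := (unicritical p c)^[k + m] z) (by nlinarith)
        rw [pow_succ]
        linarith
    obtain ⟨C, hC⟩ := isBounded_iff_forall_norm_le.1 (mem_ofPred.1 hz)
    obtain ⟨k, hk⟩ := pow_unbounded_of_one_lt C (one_lt_two (α := ℝ))
    have h1 := hC _ ⟨k + m, rfl⟩
    have h2 := hgrow k
    have h3 : (0 : ℝ) < 2 ^ k := by positivity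
    dsimp only at h1
    nlinarith
  · intro h
    rw [filledJulia, mem_ofPred_eq, isBounded_iff_forall_norm_le]
    refine ⟨‖c‖ + 2, ?_⟩
    rintro _ ⟨m, rfl⟩
    exact h m

theorem filledJulia_eq_iInter (hp : 2 ≤ p) :
    filledJulia p c = ⋂ m, (unicritical p c)^[m] ⁻¹' closedBall 0 (‖c‖ + 2) := by
  ext z
  simp [mem_filledJulia_iff hp]

theorem antitone_preimage_iterate_unicritical (hp : 2 ≤ p) :
    Antitone fun m => (unicritical p c)^[m] ⁻¹' closedBall 0 (‖c‖ + 2) := by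
  refine antitone_nat_of_succ_le fun m z hz => ?_
  simp only [mem_preimage, mem_closedBall_zero_iff] at hz ⊢
  exact norm_iterate_le_of_norm_iterate_succ_le hp hz

theorem isCompact_preimage_iterate_unicritical (hp : 2 ≤ p) (m : ℕ) :
    IsCompact ((unicritical p c)^[m] ⁻¹' closedBall 0 (‖c‖ + 2)) :=
  (isCompact_closedBall (0 : ℂ) (‖c‖ + 2)).of_isClosed_subset
    (isClosed_closedBall.preimage (differentiable_iterate_unicritical m).continuous)
    (antitone_preimage_iterate_unicritical hp (Nat.zero_le m))

theorem isCompact_filledJulia (hp : 2 ≤ p) : IsCompact (filledJulia p c) := by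
  rw [filledJulia_eq_iInter hp]
  exact (isCompact_preimage_iterate_unicritical hp 0).of_isClosed_subset
    (isClosed_iInter fun m => (isCompact_preimage_iterate_unicritical hp m).isClosed)
    (iInter_subset _ 0)

theorem unicritical_mem_filledJulia_iff (hp : 2 ≤ p) {z : ℂ} :
    unicritical p c z ∈ filledJulia p c ↔ z ∈ filledJulia p c := by
  simp only [mem_filledJulia_iff hp, ← Function.iterate_succ_apply]
  exact ⟨fun h m => norm_iterate_le_of_norm_iterate_succ_le hp (h m), fun h m => h (m + 1)⟩

theorem subset_filledJulia_of_frontier_subset (hp : 2 ≤ p) {U : Set ℂ}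
    (hU : IsBounded U) (hfr : frontier U ⊆ filledJulia p c) : U ⊆ filledJulia p c := by
  intro z hz
  refine (mem_filledJulia_iff hp).2 fun m => ?_
  exact Complex.norm_le_of_forall_mem_frontier_norm_le hU
    (differentiable_iterate_unicritical m).diffContOnCl
    (fun w hw => (mem_filledJulia_iff hp).1 (hfr hw) m) (subset_closure hz)

theorem isConnected_filledJulia_of_zero_mem (hp : 2 ≤ p) (h0 : (0 : ℂ) ∈ filledJulia p c) :
    IsConnected (filledJulia p c) := by
  have hp0 : p ≠ 0 := by omega
  have : NeZero p := ⟨hp0⟩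
  refine ⟨⟨0, h0⟩, ?_⟩
  have ho : IsOpenMap (unicritical p c) :=
    (Homeomorph.addRight c).isOpenMap.comp (Complex.isOpenQuotientMap_pow p).isOpenMap
  have hcl : IsClosedMap (unicritical p c) :=
    (Homeomorph.addRight c).isClosedMap.comp (isClosedMap_pow ℂ p)
  rw [filledJulia_eq_iInter hp]
  refine isPreconnected_iInter_of_antitone (antitone_preimage_iterate_unicritical hp)
    (isCompact_preimage_iterate_unicritical hp) fun m => ?_
  induction m with
  | zero => exact (convex_closedBall (0 : ℂ) (‖c‖ + 2)).isPreconnected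
  | succ m ih =>
    rw [Function.iterate_succ, preimage_comp]
    refine ih.preimage_of_isOpenMap_of_isClosedMap ho hcl (a := 0) ?_ fun x hx => ?_
    · rw [mem_preimage, ← Function.iterate_succ_apply, mem_closedBall_zero_iff]
      exact (mem_filledJulia_iff hp).1 h0 (m + 1)
    · simpa [unicritical, hp0] using hx

theorem zero_mem_filledJulia_of_isConnected (hp : 2 ≤ p) (h : IsConnected (filledJulia p c)) :
    (0 : ℂ) ∈ filledJulia p c := by
  have hp0 : p ≠ 0 := by omega
  by_contra h0
  have hc : c ∉ filledJulia p c := by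
    rw [← unicritical_mem_filledJulia_iff hp] at h0
    simpa [unicritical, hp0] using h0
  obtain ⟨g, hg, hgp⟩ := hasContinuousRoot_of_notMem hp0 (isCompact_filledJulia hp)
    (fun U _ hU => subset_filledJulia_of_frontier_subset hp hU) hc
  have hmaps : MapsTo (unicritical p c) (filledJulia p c) (filledJulia p c) :=
    fun z hz => (unicritical_mem_filledJulia_iff hp).2 hz
  have hgf : ∀ z ∈ filledJulia p c, g (unicritical p c z) ^ p = z ^ p := fun z hz => by
    rw [hgp _ (hmaps hz), unicritical, add_sub_cancel_right]
  have hz0 : ∀ z ∈ filledJulia p c, z ≠ 0 := fun z hz h => h0 (h ▸ hz)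
  have hg0 : ∀ z ∈ filledJulia p c, g (unicritical p c z) ≠ 0 := fun z hz h => by
    have := hgf z hz
    rw [h, zero_pow hp0] at this
    exact pow_ne_zero p (hz0 z hz) this.symm
  have hcont : ContinuousOn (fun z => z / g (unicritical p c z)) (filledJulia p c) :=
    continuousOn_id.div
      (hg.comp (differentiable_iterate_unicritical 1).continuous.continuousOn hmaps) hg0
  have hroots : MapsTo (fun z => z / g (unicritical p c z)) (filledJulia p c)
      (Polynomial.nthRootsFinset p (1 : ℂ)) := fun z hz => by
    rw [Finset.mem_coe, Polynomial.mem_nthRootsFinset (by omega), div_pow, hgf z hz,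
      div_self (pow_ne_zero p (hz0 z hz))]
  have hω := Complex.isPrimitiveRoot_exp p hp0
  set ω := Complex.exp (2 * Real.pi * Complex.I / p)
  obtain ⟨z, hz⟩ := h.nonempty
  have hrot : unicritical p c (ω * z) = unicritical p c z := by
    rw [unicritical, mul_pow, hω.pow_eq_one, one_mul]
    rfl
  have hωz : ω * z ∈ filledJulia p c := by
    rwa [← unicritical_mem_filledJulia_iff hp, hrot, unicritical_mem_filledJulia_iff hp]
  have heq := h.isPreconnected.constant_of_mapsTo (Finset.finite_toSet _).isDiscrete hcont hroots
    hωz hz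
  rw [hrot, div_left_inj' (hg0 z hz)] at heq
  exact hω.ne_one (by omega) ((mul_eq_right₀ (hz0 z hz)).1 heq)

end FilledJulia

/-- The filled-in Julia set of `f_c(z) = z^p + c` is connected if and only if
the orbit of `0` under `f_c` is bounded, i.e. `0` belongs to the set. -/
theorem filledJulia_isConnected_iff (p : ℕ) (hp : 2 ≤ p) (c : ℂ) :
    IsConnected {z : ℂ | Bornology.IsBounded
        (Set.range fun m : ℕ => (fun w : ℂ => w ^ p + c)^[m] z)} ↔
      (0 : ℂ) ∈ {z : ℂ | Bornology.IsBounded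
        (Set.range fun m : ℕ => (fun w : ℂ => w ^ p + c)^[m] z)} :=
  ⟨zero_mem_filledJulia_of_isConnected hp, isConnected_filledJulia_of_zero_mem hp⟩
end

section
/- Let p ≥ 2 be an integer. In the idempotent representation of the bicomplex numbers as the product ring ℂ × ℂ, the bicomplex Multibrot set M_2^p = {c ∈ ℂ × ℂ : the sequence (f_c^m(0))_{m≥1} is bounded}, where f_c(w) = w^p + c acts componentwise, equals the Cartesian product M^p × M^p of two copies of the complex Multibrot set of order p. -/
/-- In the idempotent representation (bicomplex numbers as `ℂ × ℂ` with componentwise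
operations), the bicomplex Multibrot set `M_2^p` equals the Cartesian product
`M^p ×ˢ M^p` of two copies of the complex Multibrot set of order `p`. -/
theorem bicomplex_multibrot_eq_prod (p : ℕ) (hp : 2 ≤ p) :
    {c : ℂ × ℂ | Bornology.IsBounded
        (Set.range fun m : ℕ => (fun v : ℂ × ℂ => v ^ p + c)^[m] 0)} =
      {c : ℂ | Bornology.IsBounded
          (Set.range fun m : ℕ => (fun v : ℂ => v ^ p + c)^[m] 0)} ×ˢ
        {c : ℂ | Bornology.IsBounded
          (Set.range fun m : ℕ => (fun v : ℂ => v ^ p + c)^[m] 0)} := by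
  ext ⟨a, b⟩
  have iterate_eq (m : ℕ) : (fun v : ℂ × ℂ => v ^ p + (a, b))^[m] 0 =
      ((fun v : ℂ => v ^ p + a)^[m] 0, (fun v : ℂ => v ^ p + b)^[m] 0) :=
    congrFun (Prod.map_iterate (fun v : ℂ => v ^ p + a) (fun v : ℂ => v ^ p + b) m) (0, 0)
  simp only [Set.mem_prod, Set.mem_ofPred_eq, iterate_eq,
    ← Bornology.isBounded_image_fst_and_snd, ← Set.range_comp, Function.comp_def]
end

section
/- Let p ≥ 2 be an integer. The bicomplex Multibrot set M_2^p = {c ∈ ℂ × ℂ : (f_c^m(0))_{m≥1} is bounded}, where ℂ × ℂ carries componentwise ring operations and f_c(w) = w^p + c, is a compact subset of ℂ × ℂ. -/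
section Multibrot

open Function

lemma norm_mul_le_norm_pow_add {𝕜 : Type*} [NormedDivisionRing 𝕜] {p : ℕ} (hp : 2 ≤ p)
    {c z : 𝕜} {r : ℝ} (hr : 1 ≤ r) (hz : r + 1 ≤ ‖z‖) (hc : ‖c‖ ≤ ‖z‖) :
    r * ‖z‖ ≤ ‖z ^ p + c‖ := by
  have hpow : ‖z‖ ^ 2 ≤ ‖z‖ ^ p := pow_le_pow_right₀ (by linarith) hp
  have htri : ‖z‖ ^ p - ‖c‖ ≤ ‖z ^ p + c‖ := by
    simpa only [norm_pow] using norm_sub_le_norm_add (z ^ p) c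
  nlinarith [norm_nonneg z]

/-- Beyond radius `2` and `‖c‖`, the orbits of `z ↦ z ^ p + c` grow at least geometrically. -/
lemma pow_mul_norm_le_norm_iterate {𝕜 : Type*} [NormedDivisionRing 𝕜] {p : ℕ} (hp : 2 ≤ p)
    {c z : 𝕜} {r : ℝ} (hr : 1 ≤ r) (hz : r + 1 ≤ ‖z‖) (hc : ‖c‖ ≤ ‖z‖) (n : ℕ) :
    r ^ n * ‖z‖ ≤ ‖(fun v : 𝕜 => v ^ p + c)^[n] z‖ := by
  induction n with
  | zero => simp
  | succ n ih =>
    have hle : ‖z‖ ≤ ‖(fun v : 𝕜 => v ^ p + c)^[n] z‖ :=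
      (le_mul_of_one_le_left (norm_nonneg z) (one_le_pow₀ hr)).trans ih
    rw [iterate_succ_apply']
    calc r ^ (n + 1) * ‖z‖ = r * (r ^ n * ‖z‖) := by ring
      _ ≤ r * ‖(fun v : 𝕜 => v ^ p + c)^[n] z‖ := by gcongr
      _ ≤ _ := norm_mul_le_norm_pow_add hp hr (hz.trans hle) (hc.trans hle)

/-- Every point of a bounded critical orbit of `z ↦ z ^ p + c` has norm at most `2`. -/
lemma norm_iterate_zero_le_two {𝕜 : Type*} [NormedDivisionRing 𝕜] {p : ℕ} (hp : 2 ≤ p)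
    {c : 𝕜} {C : ℝ} (hC : ∀ m, ‖(fun v : 𝕜 => v ^ p + c)^[m] 0‖ ≤ C) (m : ℕ) :
    ‖(fun v : 𝕜 => v ^ p + c)^[m] 0‖ ≤ 2 := by
  have key (k : ℕ) (hk : ‖c‖ ≤ ‖(fun v : 𝕜 => v ^ p + c)^[k] 0‖) :
      ‖(fun v : 𝕜 => v ^ p + c)^[k] 0‖ ≤ 2 := by
    by_contra! h
    set z := (fun v : 𝕜 => v ^ p + c)^[k] 0
    obtain ⟨n, hn⟩ := pow_unbounded_of_one_lt C (show 1 < ‖z‖ - 1 by linarith)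
    have hgrow := pow_mul_norm_le_norm_iterate hp (r := ‖z‖ - 1) (by linarith) (by linarith) hk n
    have hbound := hC (n + k)
    rw [iterate_add_apply] at hbound
    have hmul : (‖z‖ - 1) ^ n ≤ (‖z‖ - 1) ^ n * ‖z‖ :=
      le_mul_of_one_le_right (pow_nonneg (by linarith) n) (by linarith)
    linarith
  have hone : (fun v : 𝕜 => v ^ p + c)^[1] 0 = c := by
    simp [zero_pow (by omega : p ≠ 0)]
  have hc : ‖c‖ ≤ 2 := by simpa only [hone] using key 1 (by rw [hone])
  by_contra! h
  exact h.not_ge (key m (hc.trans h.le))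

lemma continuous_iterate_pow_add {R : Type*} [Semiring R] [TopologicalSpace R]
    [IsTopologicalSemiring R] (p m : ℕ) (z : R) :
    Continuous fun c : R => (fun v : R => v ^ p + c)^[m] z := by
  induction m with
  | zero => exact continuous_const
  | succ m ih =>
    simp only [iterate_succ_apply']
    exact (ih.pow p).add continuous_id

lemma map_iterate_pow_add {R S : Type*} [Semiring R] [Semiring S] (φ : R →+* S) (p m : ℕ)
    (c z : R) :
    φ ((fun v : R => v ^ p + c)^[m] z) = (fun v : S => v ^ p + φ c)^[m] (φ z) :=
  Semiconj.iterate_right (f := φ) (fun v => by simp) m z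

lemma isBounded_range_iterate_iff {𝕜 𝕜' : Type*} [NormedDivisionRing 𝕜] [NormedDivisionRing 𝕜']
    {p : ℕ} (hp : 2 ≤ p) (c : 𝕜 × 𝕜') :
    Bornology.IsBounded (Set.range fun m : ℕ => (fun v : 𝕜 × 𝕜' => v ^ p + c)^[m] 0) ↔
      ∀ m : ℕ, ‖(fun v : 𝕜 × 𝕜' => v ^ p + c)^[m] 0‖ ≤ 2 := by
  rw [isBounded_iff_forall_norm_le]
  simp only [Set.forall_mem_range]
  refine ⟨fun ⟨C, hC⟩ m => ?_, fun h => ⟨2, h⟩⟩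
  have hfst (k : ℕ) := map_iterate_pow_add (RingHom.fst 𝕜 𝕜') p k c 0
  have hsnd (k : ℕ) := map_iterate_pow_add (RingHom.snd 𝕜 𝕜') p k c 0
  simp only [RingHom.coe_fst, RingHom.coe_snd, Prod.fst_zero, Prod.snd_zero] at hfst hsnd
  refine norm_prod_le_iff.2 ⟨?_, ?_⟩
  · rw [hfst]
    exact norm_iterate_zero_le_two hp (fun k => hfst k ▸ (norm_fst_le _).trans (hC k)) m
  · rw [hsnd]
    exact norm_iterate_zero_le_two hp (fun k => hsnd k ▸ (norm_snd_le _).trans (hC k)) m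

end Multibrot

/-- The bicomplex Multibrot set `M_2^p` is a compact subset of `ℂ × ℂ`. -/
theorem bicomplex_multibrot_isCompact (p : ℕ) (hp : 2 ≤ p) :
    IsCompact {c : ℂ × ℂ | Bornology.IsBounded
        (Set.range fun m : ℕ => (fun v : ℂ × ℂ => v ^ p + c)^[m] 0)} := by
  simp only [isBounded_range_iterate_iff hp]
  refine Metric.isCompact_of_isClosed_isBounded ?_ ?_
  · rw [Set.ofPred_forall]
    exact isClosed_iInter fun m =>
      isClosed_le (continuous_iterate_pow_add p m 0).norm continuous_const
  · refine isBounded_iff_forall_norm_le.2 ⟨2, fun c hc => ?_⟩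
    simpa [zero_pow (by omega : p ≠ 0)] using hc 1
end
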